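/- Let p₁ ≠ p₂ be primes both greater than 3, and let L ≤ SL₂(ℤ) be a subgroup whose reduction modulo p₁ is all of SL₂(ℤ/p₁ℤ) and whose reduction modulo p₂ is all of SL₂(ℤ/p₂ℤ). Then the reduction of L modulo p₁p₂ is all of SL₂(ℤ/p₁p₂ℤ). -/

import Mathlib

open Matrix

namespace Matrix.SpecialLinearGroup

/-- The `n`-th power of a transvection multiplies its coefficient by `n`. -/
theorem transvection_pow {ι F : Type*} [Fintype ι] [DecidableEq ι] [CommRing F] {i j : ι}
    (hij : i ≠ j) (b : F) (n : ℕ) :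
    transvection hij b ^ n = transvection hij (n * b) := by
  induction n with
  | zero => simp
  | succ n ih => rw [pow_succ, ih, ← transvection_add, Nat.cast_succ, add_one_mul]

/-- A prime `q` larger than a prime `p > 2` does not divide the order of `SL₂(𝔽_p)`. -/
theorem not_dvd_card_fin_two_zmod {p q : ℕ} [Fact p.Prime] (hq : q.Prime) (hp2 : 2 < p)
    (hpq : p < q) : ¬ q ∣ Nat.card (SpecialLinearGroup (Fin 2) (ZMod p)) := by
  have hp : p.Prime := Fact.out
  intro h
  have hdvd : q ∣ Nat.card (GL (Fin 2) (ZMod p)) :=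
    h.trans (Subgroup.card_dvd_of_injective toGL toGL_injective)
  have h₁ : p ^ 2 - 1 = (p + 1) * (p - 1) := by simpa using Nat.sq_sub_sq p 1
  have h₂ : p ^ 2 - p = p * (p - 1) := by rw [sq, Nat.mul_sub_one]
  simp only [card_GL_field, Fin.prod_univ_two, Fintype.card_eq_nat_card, Nat.card_zmod,
    Fin.val_zero, Fin.val_one, pow_zero, pow_one, h₁, h₂, hq.dvd_mul] at hdvd
  have hlt : ¬ q ∣ p - 1 := Nat.not_dvd_of_pos_of_lt (by omega) (by omega)
  have hlt' : ¬ q ∣ p := Nat.not_dvd_of_pos_of_lt (by omega) hpq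
  have := Nat.le_of_dvd (by omega) (by tauto : q ∣ p + 1)
  have := hp.eq_two_or_odd
  have := hq.eq_two_or_odd
  omega

/-- If a subgroup of a group `G` surjects, via `f`, onto a finite group whose order is nonzero
in `F` and, via `g`, onto `SL₂(F)`, then it surjects onto their product. -/
theorem exists_mem_map_eq_and_map_eq {G H F : Type*} [Group G] [Group H] [Field F]
    (f : G →* H) (g : G →* SpecialLinearGroup (Fin 2) F) (hH : (Nat.card H : F) ≠ 0)
    (L : Subgroup G) (hf : ∀ x, ∃ γ ∈ L, f γ = x) (hg : ∀ y, ∃ γ ∈ L, g γ = y)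
    (x : H) (y : SpecialLinearGroup (Fin 2) F) : ∃ γ ∈ L, f γ = x ∧ g γ = y := by
  have hker : ∀ z, z ∈ (L ⊓ f.ker).map g := by
    refine SL2.transvection_induction _ (fun i j hij c ↦ ?_) fun _ _ ↦ mul_mem
    obtain ⟨γ, hγ, hγc⟩ := hg (transvection hij ((Nat.card H : F)⁻¹ * c))
    refine ⟨γ ^ Nat.card H, ⟨pow_mem hγ _, ?_⟩, ?_⟩
    · simp
    · rw [map_pow, hγc, transvection_pow, mul_inv_cancel_left₀ hH]
  obtain ⟨γ, hγ, rfl⟩ := hf x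
  obtain ⟨δ, ⟨hδ, hδf⟩, hδg⟩ := hker ((g γ)⁻¹ * y)
  exact ⟨γ * δ, mul_mem hγ hδ, by simp [MonoidHom.mem_ker.1 hδf], by simp [hδg]⟩

/-- For primes `2 < p < q`, a subgroup of `SL₂(ℤ)` surjecting onto `SL₂(𝔽_p)` and onto `SL₂(𝔽_q)`
surjects onto their product. -/
theorem exists_mem_map_zmod_eq_and_map_zmod_eq {p q : ℕ} (hp : p.Prime) (hq : q.Prime)
    (hp2 : 2 < p) (hpq : p < q) (L : Subgroup (SpecialLinearGroup (Fin 2) ℤ))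
    (hLp : ∀ x : SpecialLinearGroup (Fin 2) (ZMod p),
      ∃ γ ∈ L, map (Int.castRingHom (ZMod p)) γ = x)
    (hLq : ∀ x : SpecialLinearGroup (Fin 2) (ZMod q),
      ∃ γ ∈ L, map (Int.castRingHom (ZMod q)) γ = x)
    (x : SpecialLinearGroup (Fin 2) (ZMod p)) (y : SpecialLinearGroup (Fin 2) (ZMod q)) :
    ∃ γ ∈ L, map (Int.castRingHom (ZMod p)) γ = x ∧ map (Int.castRingHom (ZMod q)) γ = y := by
  have := Fact.mk hp
  have := Fact.mk hq
  refine exists_mem_map_eq_and_map_eq _ _ ?_ L hLp hLq x y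
  rw [Ne, ZMod.natCast_eq_zero_iff]
  exact not_dvd_card_fin_two_zmod hq hp2 hpq

/-- Two elements of `SL_n(ℤ/ab)` with `a`, `b` coprime agree if they agree modulo `a` and `b`. -/
theorem eq_of_map_castHom_eq {ι : Type*} [Fintype ι] [DecidableEq ι] {a b : ℕ}
    (hab : a.Coprime b) {x y : SpecialLinearGroup ι (ZMod (a * b))}
    (ha : map (ZMod.castHom (dvd_mul_right a b) (ZMod a)) x =
      map (ZMod.castHom (dvd_mul_right a b) (ZMod a)) y)
    (hb : map (ZMod.castHom (dvd_mul_left b a) (ZMod b)) x =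
      map (ZMod.castHom (dvd_mul_left b a) (ZMod b)) y) :
    x = y := by
  ext i j
  refine (ZMod.chineseRemainder hab).injective (Prod.ext ?_ ?_)
  · have := congr_arg (fun z ↦ z.1 i j) ha
    simpa [ZMod.chineseRemainder] using this
  · have := congr_arg (fun z ↦ z.1 i j) hb
    simpa [ZMod.chineseRemainder] using this

end Matrix.SpecialLinearGroup

/-- If a subgroup `L ≤ SL₂(ℤ)` surjects onto `SL₂(ℤ/p₁)` and onto `SL₂(ℤ/p₂)` for distinct
primes `p₁, p₂ > 3`, then it surjects onto `SL₂(ℤ/p₁p₂)`. -/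
theorem sl2_surjective_of_two_primes (p₁ p₂ : ℕ) (hp₁ : p₁.Prime) (hp₂ : p₂.Prime)
    (h₁3 : 3 < p₁) (h₂3 : 3 < p₂) (hne : p₁ ≠ p₂)
    (L : Subgroup (Matrix.SpecialLinearGroup (Fin 2) ℤ))
    (hs₁ : ∀ x : Matrix.SpecialLinearGroup (Fin 2) (ZMod p₁),
      ∃ γ ∈ L, Matrix.SpecialLinearGroup.map (Int.castRingHom (ZMod p₁)) γ = x)
    (hs₂ : ∀ x : Matrix.SpecialLinearGroup (Fin 2) (ZMod p₂),
      ∃ γ ∈ L, Matrix.SpecialLinearGroup.map (Int.castRingHom (ZMod p₂)) γ = x) :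
    ∀ x : Matrix.SpecialLinearGroup (Fin 2) (ZMod (p₁ * p₂)),
      ∃ γ ∈ L, Matrix.SpecialLinearGroup.map (Int.castRingHom (ZMod (p₁ * p₂))) γ = x := by
  intro x
  set x₁ := SpecialLinearGroup.map (ZMod.castHom (dvd_mul_right p₁ p₂) (ZMod p₁)) x with hx₁
  set x₂ := SpecialLinearGroup.map (ZMod.castHom (dvd_mul_left p₂ p₁) (ZMod p₂)) x with hx₂
  obtain ⟨γ, hγ, h₁, h₂⟩ : ∃ γ ∈ L, SpecialLinearGroup.map (Int.castRingHom (ZMod p₁)) γ = x₁ ∧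
      SpecialLinearGroup.map (Int.castRingHom (ZMod p₂)) γ = x₂ := by
    rcases hne.lt_or_gt with h | h
    · exact SpecialLinearGroup.exists_mem_map_zmod_eq_and_map_zmod_eq hp₁ hp₂ (by omega) h L
        hs₁ hs₂ x₁ x₂
    · obtain ⟨γ, hγ, h₂, h₁⟩ := SpecialLinearGroup.exists_mem_map_zmod_eq_and_map_zmod_eq hp₂ hp₁
        (by omega) h L hs₂ hs₁ x₂ x₁
      exact ⟨γ, hγ, h₁, h₂⟩
  refine ⟨γ, hγ, SpecialLinearGroup.eq_of_map_castHom_eq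
    ((Nat.coprime_primes hp₁ hp₂).2 hne) ?_ ?_⟩
  · rw [← hx₁, ← h₁]
    ext i j
    simp
  · rw [← hx₂, ← h₂]
    ext i j
    simp
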